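/- arXiv:2001.00327 — 3 statements merged into one kernel-verified Lean document; each statement's English description precedes it below -/
import Mathlib

section
/- Let n ≥ 1, let c ≥ 2, and let C ⊆ ZMod n be the image of {0, 1, ..., c-1}. Then for any nonempty finite sets A, B ⊆ ZMod n, |A + B + C| ≥ min{n, |A| + |B| + (c-2)}. -/
open Finset Pointwise

/-- The `k`-fold Minkowski sum `kA = A + ⋯ + A` (with `0A = {0}`). -/
def iterSum {n : ℕ} : ℕ → Finset (ZMod n) → Finset (ZMod n)
  | 0, _ => {0}
  | j + 1, A => A + iterSum j A

/-- The noisy `k`-fold sum `k *_C A = kA + (k-1)C`. -/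
def noisy {n : ℕ} (C : Finset (ZMod n)) (k : ℕ) (A : Finset (ZMod n)) :
    Finset (ZMod n) :=
  iterSum k A + iterSum (k - 1) C

/-- `A` is `C`-`(k,ℓ)`-sum-free: `(k *_C A) ∩ (ℓ *_C A) = ∅`. -/
def SumFree {n : ℕ} (C : Finset (ZMod n)) (k l : ℕ) (A : Finset (ZMod n)) : Prop :=
  noisy C k A ∩ noisy C l A = ∅

/-- `μ^C_{k,ℓ}(ZMod n)`: the maximum size of a `C`-`(k,ℓ)`-sum-free subset of `ZMod n`. -/
noncomputable def mu (n : ℕ) (k l : ℕ) (C : Finset (ZMod n)) : ℕ :=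
  sSup {m | ∃ A : Finset (ZMod n), SumFree C k l A ∧ A.card = m}

/-- The stabilizer `stab(X) = {g : g + X = X}` of a finite subset of `ZMod n`. -/
def stab {n : ℕ} (X : Finset (ZMod n)) : Set (ZMod n) :=
  {g | X.image (g + ·) = X}

/-- A nonempty subset of `ZMod n` closed under adding `1` is everything. -/
theorem eq_univ_of_add_one_mem {n : ℕ} [NeZero n] {A : Finset (ZMod n)} (hA : A.Nonempty)
    (h : ∀ a ∈ A, a + 1 ∈ A) : A = univ := by
  obtain ⟨a, ha⟩ := hA
  have shift : ∀ k : ℕ, a + (k : ZMod n) ∈ A := by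
    intro k
    induction k with
    | zero => simpa using ha
    | succ k ih => simpa [add_assoc] using h _ ih
  refine eq_univ_of_forall fun x => ?_
  simpa using shift (x - a).val

/-- If `A` is invariant under translation by differences of elements of `B`, then
`A + {0, 1}` exceeds `A` by at least the size of `B`. -/
theorem card_add_zero_one_of_forall_add_sub_mem {n : ℕ} [NeZero n] {A B : Finset (ZMod n)}
    (hA : A.Nonempty) (hB : B.Nonempty) (h : ∀ a ∈ A, ∀ b ∈ B, ∀ b' ∈ B, a + (b' - b) ∈ A) :
    min n (#A + #B) ≤ #(A + {0, 1}) := by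
  have hsub : A ⊆ A + {0, 1} := subset_add_left A (by simp)
  by_cases hclosed : ∀ a ∈ A, a + 1 ∈ A
  · have hcard : #A = n := by simp [eq_univ_of_add_one_mem hA hclosed, ZMod.card]
    exact (min_le_left _ _).trans (hcard.symm.le.trans (card_le_card hsub))
  push Not at hclosed
  obtain ⟨a, ha, ha'⟩ := hclosed
  obtain ⟨b, hb⟩ := hB
  have hdisj : Disjoint A (B.image fun b' => a + (b' - b) + 1) := by
    rw [disjoint_right]
    intro x hx hxA
    obtain ⟨b', hb', rfl⟩ := mem_image.1 hx
    exact ha' (by convert h _ hxA b' hb' b hb using 1; ring)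
  have hinj : #(B.image fun b' => a + (b' - b) + 1) = #B :=
    card_image_of_injective _ fun x y hxy => by simpa using hxy
  refine (min_le_right _ _).trans ?_
  rw [← hinj, ← card_union_of_disjoint hdisj]
  refine card_le_card (union_subset hsub fun x hx => ?_)
  obtain ⟨b', hb', rfl⟩ := mem_image.1 hx
  exact add_mem_add (h a ha b hb b' hb') (by simp)

/-- The case of noise `{0, 1}`, by the Dyson transform. -/
theorem min_card_add_card_le_card_add_zero_one {n : ℕ} [NeZero n] (A B : Finset (ZMod n))
    (hA : A.Nonempty) (hB : B.Nonempty) : min n (#A + #B) ≤ #(A + B + {0, 1}) := by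
  induction hm : #B using Nat.strong_induction_on generalizing A B with
  | _ m ih =>
  subst hm
  by_cases h : ∀ a ∈ A, ∀ b ∈ B, ∀ b' ∈ B, a + (b' - b) ∈ A
  · refine (card_add_zero_one_of_forall_add_sub_mem hA hB h).trans ?_
    obtain ⟨b, hb⟩ := hB
    rw [add_right_comm]
    exact card_le_card_add_right ⟨b, hb⟩
  push Not at h
  obtain ⟨a, ha, b, hb, b', hb', hmem⟩ := h
  have hcard := addDysonETransform.card (a - b) (A, B)
  have hsub := addDysonETransform.subset (a - b) (A, B)
  have hfst : A ⊆ (addDysonETransform (a - b) (A, B)).1 := by simp [addDysonETransform]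
  have hsnd : (addDysonETransform (a - b) (A, B)).2 ⊂ B := by
    refine (ssubset_iff_of_subset (by simp [addDysonETransform])).2 ⟨b', hb', ?_⟩
    simp only [addDysonETransform, mem_inter, not_and]
    intro _ hx
    rw [mem_neg_vadd_finset_iff] at hx
    exact hmem (by convert hx using 1; simp only [vadd_eq_add]; ring)
  have hne : (addDysonETransform (a - b) (A, B)).2.Nonempty := by
    refine ⟨b, mem_inter.2 ⟨hb, ?_⟩⟩
    rw [mem_neg_vadd_finset_iff]
    simpa using ha
  have key := ih _ (card_lt_card hsnd) _ _ (hA.mono hfst) hne rfl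
  rw [hcard] at key
  exact key.trans (card_le_card (add_subset_add_right hsub))

/-- Adding an initial segment of length `k + 1` enlarges a nonempty set by at least `k`. -/
theorem min_card_add_le_card_add_image_range {n : ℕ} [NeZero n] (X : Finset (ZMod n))
    (hX : X.Nonempty) (k : ℕ) :
    min n (#X + k) ≤ #(X + (range (k + 1)).image (Nat.cast : ℕ → ZMod n)) := by
  induction k with
  | zero => simp
  | succ k ih =>
    set Y := X + (range (k + 1)).image (Nat.cast : ℕ → ZMod n) with hY
    have hYne : Y.Nonempty := hX.add (by simp)
    have hstep : min n (#Y + 1) ≤ #(Y + {0, 1}) := by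
      simpa using card_add_zero_one_of_forall_add_sub_mem hYne (singleton_nonempty 0) (by simp)
    have hsub : Y + {0, 1} ⊆ X + (range (k + 1 + 1)).image (Nat.cast : ℕ → ZMod n) := by
      rw [hY, add_assoc]
      refine add_subset_add_left (add_subset_iff.2 fun x hx y hy => ?_)
      obtain ⟨i, hi, rfl⟩ := mem_image.1 hx
      rw [mem_range] at hi
      rw [mem_insert, mem_singleton] at hy
      rcases hy with rfl | rfl
      · exact mem_image.2 ⟨i, mem_range.2 (by lia), by simp⟩
      · exact mem_image.2 ⟨i + 1, mem_range.2 (by lia), by simp⟩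
    have := card_le_card hsub
    lia

theorem stmt6 (n : ℕ) [NeZero n] (c : ℕ) (hc : 2 ≤ c)
    (C : Finset (ZMod n)) (hC : C = (Finset.range c).image (Nat.cast : ℕ → ZMod n))
    (A B : Finset (ZMod n)) (hA : A.Nonempty) (hB : B.Nonempty) :
    min n (A.card + B.card + (c - 2)) ≤ (A + B + C).card := by
  obtain ⟨k, rfl⟩ := Nat.exists_eq_add_of_le' hc
  have hbase := min_card_add_card_le_card_add_zero_one A B hA hB
  have hgrow := min_card_add_le_card_add_image_range (A + B + {0, 1})
    ((hA.add hB).add (by simp)) k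
  have hsub : A + B + {0, 1} + (range (k + 1)).image (Nat.cast : ℕ → ZMod n) ⊆ A + B + C := by
    rw [add_assoc]
    refine add_subset_add_left (add_subset_iff.2 fun y hy x hx => ?_)
    obtain ⟨i, hi, rfl⟩ := mem_image.1 hx
    rw [mem_range] at hi
    rw [mem_insert, mem_singleton] at hy
    rw [hC]
    rcases hy with rfl | rfl
    · exact mem_image.2 ⟨i, mem_range.2 (by lia), by simp⟩
    · exact mem_image.2 ⟨i + 1, mem_range.2 (by lia), by push_cast; ring⟩
  have := card_le_card hsub
  lia
end

section
/- Let n ≥ 1, let c ≥ 2, let C ⊆ ZMod n be the image of {0, 1, ..., c-1}, and let k ≥ 1. Then for any nonempty finite set A ⊆ ZMod n, |k *_C A| ≥ min{n, k·|A| + (k-1)(c-2)}. -/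
open Finset Pointwise

/-- A subset of `ZMod n` closed under adding `1` is everything as soon as it is nonempty. -/
lemma eq_univ_of_add_one_mem_s7 {n : ℕ} [NeZero n] {X : Finset (ZMod n)} (hX : X.Nonempty)
    (h : ∀ x ∈ X, x + 1 ∈ X) : X = univ := by
  obtain ⟨x, hx⟩ := hX
  have hm : ∀ m : ℕ, x + (m : ZMod n) ∈ X := by
    intro m
    induction m with
    | zero => simpa using hx
    | succ m ih => simpa [add_assoc] using h _ ih
  refine eq_univ_of_forall fun y => ?_
  simpa using hm (y - x).val

lemma card_add_le_card_add_pair_of_zero_mem {n : ℕ} [NeZero n] {X A : Finset (ZMod n)}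
    (hX : X.Nonempty) (hA : 0 ∈ A) : min n (#X + #A) ≤ #(X + A + {0, 1}) := by
  induction hs : #A using Nat.strong_induction_on generalizing X A with
  | _ s ih =>
  subst hs
  by_cases hinv : ∀ e ∈ X, ∀ a ∈ A, a + e ∈ X
  · have hXS : X ⊆ X + A + {0, 1} := fun x hx => by
      simpa using add_mem_add (add_mem_add hx hA) (mem_insert_self (0 : ZMod n) {1})
    by_cases hone : ∀ x ∈ X, x + 1 ∈ X
    · have hc := card_le_card hXS
      rw [eq_univ_of_add_one_mem_s7 hX hone, card_univ, ZMod.card] at hc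
      rw [eq_univ_of_add_one_mem_s7 hX hone]
      exact (min_le_left _ _).trans hc
    · push Not at hone
      obtain ⟨x, hx, hx1⟩ := hone
      -- translation by an element of `A` permutes `X`
      have hperm : ∀ a ∈ A, ∀ y, a + y ∈ X → y ∈ X := by
        intro a ha y hy
        have himg : X.image (a + ·) = X := eq_of_subset_of_card_le
          (image_subset_iff.2 fun e he => hinv e he a ha)
          (card_image_of_injective _ (add_right_injective a)).ge
        rw [← himg] at hy
        obtain ⟨z, hz, hzy⟩ := mem_image.1 hy
        exact add_left_cancel hzy ▸ hz
      have hdisj : Disjoint X (A.image (· + (x + 1))) := by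
        rw [disjoint_right]
        intro z hz hzX
        obtain ⟨a, ha, rfl⟩ := mem_image.1 hz
        exact hx1 (hperm a ha _ hzX)
      have hsub : X ∪ A.image (· + (x + 1)) ⊆ X + A + {0, 1} := by
        refine union_subset hXS (image_subset_iff.2 fun a ha => ?_)
        rw [← add_assoc, add_comm a x]
        exact add_mem_add (add_mem_add hx ha) (by simp)
      have hc := card_le_card hsub
      rw [card_union_of_disjoint hdisj,
        card_image_of_injective _ (add_left_injective (x + 1))] at hc
      exact (min_le_right _ _).trans hc
  · push Not at hinv
    obtain ⟨e, he, b, hb, hbe⟩ := hinv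
    -- the Dyson transform of `(X, A)` at `e`
    let X' := X ∪ A.image (· + e)
    let A' := A.filter (· + e ∈ X)
    have hlt : #A' < #A := card_lt_card (filter_ssubset.2 ⟨b, hb, hbe⟩)
    have hcard : #X' + #A' = #X + #A := by
      have h1 : X ∩ A.image (· + e) = A'.image (· + e) := by
        ext z
        simp only [A', mem_inter, mem_image, mem_filter]
        constructor
        · rintro ⟨hz, a, ha, rfl⟩
          exact ⟨a, ⟨ha, hz⟩, rfl⟩
        · rintro ⟨a, ⟨ha, hz⟩, rfl⟩
          exact ⟨hz, a, ha, rfl⟩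
      have h2 := card_union_add_card_inter X (A.image (· + e))
      rwa [h1, card_image_of_injective _ (add_left_injective e),
        card_image_of_injective _ (add_left_injective e)] at h2
    have hsub : X' + A' ⊆ X + A := by
      refine add_subset_iff.2 fun y hy a ha => ?_
      obtain ⟨haA, haX⟩ := mem_filter.1 ha
      rcases mem_union.1 hy with hy | hy
      · exact add_mem_add hy haA
      · obtain ⟨d, hd, rfl⟩ := mem_image.1 hy
        rw [show d + e + a = (a + e) + d by ring]
        exact add_mem_add haX hd
    have hmain := ih _ hlt (X := X') (A := A') (hX.mono subset_union_left)
      (mem_filter.2 ⟨hA, by simpa using he⟩) rfl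
    rw [hcard] at hmain
    exact hmain.trans (card_le_card (add_subset_add_right hsub))

lemma card_add_le_card_add_pair {n : ℕ} [NeZero n] {X A : Finset (ZMod n)}
    (hX : X.Nonempty) (hA : A.Nonempty) : min n (#X + #A) ≤ #(X + A + {0, 1}) := by
  obtain ⟨a, ha⟩ := hA
  have h := card_add_le_card_add_pair_of_zero_mem hX (A := {-a} + A)
    (by simpa using add_mem_add (mem_singleton_self (-a)) ha)
  rwa [card_singleton_add, add_left_comm X, add_assoc {-a}, card_singleton_add] at h

lemma card_add_le_card_add_interval {n : ℕ} [NeZero n] {X A : Finset (ZMod n)}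
    (hX : X.Nonempty) (hA : A.Nonempty) (m : ℕ) :
    min n (#X + #A + m) ≤ #(X + A + (range (m + 2)).image (Nat.cast : ℕ → ZMod n)) := by
  induction m with
  | zero =>
    have h : (range (0 + 2)).image (Nat.cast : ℕ → ZMod n) = {0, 1} := by
      simp [range_add_one, pair_comm]
    rw [h]
    exact card_add_le_card_add_pair hX hA
  | succ m ih =>
    let I := (range (m + 2)).image (Nat.cast : ℕ → ZMod n)
    have hI : I + {0, 1} ⊆ (range (m + 1 + 2)).image (Nat.cast : ℕ → ZMod n) := by
      refine add_subset_iff.2 fun x hx y hy => ?_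
      obtain ⟨i, hi, rfl⟩ := mem_image.1 hx
      rw [mem_range] at hi
      rcases mem_insert.1 hy with rfl | hy
      · exact mem_image.2 ⟨i, mem_range.2 (by lia), by simp⟩
      · rw [mem_singleton.1 hy]
        exact mem_image.2 ⟨i + 1, mem_range.2 (by lia), by simp⟩
    have hne : (X + A + I).Nonempty := (hX.add hA).add ⟨0, mem_image.2 ⟨0, by simp⟩⟩
    have hstep := card_add_le_card_add_pair hne (singleton_nonempty (0 : ZMod n))
    rw [card_singleton, singleton_zero, add_zero, add_assoc (X + A)] at hstep
    have hle := hstep.trans (card_le_card (add_subset_add_left hI))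
    change _ ≤ #(X + A + I) at ih
    lia

lemma iterSum_nonempty {n : ℕ} {A : Finset (ZMod n)} (hA : A.Nonempty) (k : ℕ) :
    (iterSum k A).Nonempty := by
  induction k with
  | zero => exact singleton_nonempty 0
  | succ k ih => exact hA.add ih

lemma noisy_succ_succ {n : ℕ} (C A : Finset (ZMod n)) (k : ℕ) :
    noisy C (k + 2) A = noisy C (k + 1) A + A + C := by
  change A + iterSum (k + 1) A + (C + iterSum k C) = iterSum (k + 1) A + iterSum k C + A + C
  abel

theorem stmt7 (n : ℕ) [NeZero n] (c k : ℕ) (hc : 2 ≤ c) (hk : 1 ≤ k)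
    (C : Finset (ZMod n)) (hC : C = (Finset.range c).image (Nat.cast : ℕ → ZMod n))
    (A : Finset (ZMod n)) (hA : A.Nonempty) :
    min n (k * A.card + (k - 1) * (c - 2)) ≤ (noisy C k A).card := by
  obtain ⟨m, rfl⟩ := Nat.exists_eq_add_of_le' hc
  have hCne : C.Nonempty := hC ▸ ⟨0, mem_image.2 ⟨0, by simp⟩⟩
  induction k, hk using Nat.le_induction with
  | base => simp [noisy, iterSum]
  | succ k hk ih =>
    obtain ⟨k, rfl⟩ := Nat.exists_eq_add_of_le' hk
    have hne : (noisy C (k + 1) A).Nonempty :=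
      (iterSum_nonempty hA _).add (iterSum_nonempty hCne _)
    have hstep := card_add_le_card_add_interval hne hA m
    rw [← hC, ← noisy_succ_succ] at hstep
    simp only [Nat.add_sub_cancel] at ih ⊢
    have h1 : (k + 1 + 1) * #A = (k + 1) * #A + #A := by ring
    have h2 : (k + 1) * m = k * m + m := by ring
    rw [h1, h2]
    lia
end

section
/- Let n ≥ 1, let k > ℓ ≥ 1 be integers, let s ≥ 1 be an integer, and let d = gcd(s, n). Then μ^{{0,s}}_{k,ℓ}(ZMod n) ≤ max{ max over positive divisors e of d of μ_{k,ℓ}(ZMod e) · (n/e), ⌊n/(k+ℓ)⌋ }, where {0,s} is the image of {0, s} ⊆ ℤ in ZMod n. -/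
open Finset Pointwise

theorem add_le_of_dvd_of_lt {m x y : ℕ} (hx : m ∣ x) (hy : m ∣ y) (h : x < y) : x + m ≤ y := by
  obtain ⟨i, rfl⟩ := hx
  obtain ⟨j, rfl⟩ := hy
  have hij : i < j := lt_of_mul_lt_mul_left' h
  calc m * i + m = m * (i + 1) := by ring
    _ ≤ m * j := Nat.mul_le_mul_left m hij

section Kneser

variable {G : Type*} [AddCommGroup G]

/-- The stabilizer of a finite set, as a subgroup. -/
def addStab (S : Finset G) : AddSubgroup G where
  carrier := {g | ∀ x, g + x ∈ S ↔ x ∈ S}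
  zero_mem' := by simp
  add_mem' := by
    intro a b ha hb x
    rw [add_assoc, ha, hb]
  neg_mem' := by
    intro a ha x
    have h := ha (-a + x)
    rw [add_neg_cancel_left] at h
    exact h.symm

theorem sub_mem_trans {H : AddSubgroup G} {a b c : G} (h₁ : a - b ∈ H) (h₂ : b - c ∈ H) :
    a - c ∈ H := by
  simpa using H.add_mem h₁ h₂

theorem sub_mem_symm {H : AddSubgroup G} {a b : G} (h : a - b ∈ H) : b - a ∈ H := by
  simpa using H.neg_mem h

theorem mem_addStab_of_forall [DecidableEq G] {S : Finset G} {g : G} (h : ∀ x ∈ S, g + x ∈ S) :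
    g ∈ addStab S := by
  have himg : S.image (g + ·) = S := by
    apply Finset.eq_of_subset_of_card_le
    · intro y hy
      obtain ⟨x, hx, rfl⟩ := Finset.mem_image.1 hy
      exact h x hx
    · rw [Finset.card_image_of_injective _ (add_right_injective g)]
  intro x
  constructor
  · intro hx
    rw [← himg] at hx
    obtain ⟨y, hy, hxy⟩ := Finset.mem_image.1 hx
    rwa [← add_left_cancel hxy]
  · exact h x

variable [Fintype G]

open Classical in
/-- The union of the cosets of `H` that meet `S`, i.e. the set `S + H`. -/
noncomputable def cosetHull (H : AddSubgroup G) (S : Finset G) : Finset G :=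
  univ.filter fun g => ∃ u ∈ S, g - u ∈ H

theorem mem_cosetHull {H : AddSubgroup G} {S : Finset G} {g : G} :
    g ∈ cosetHull H S ↔ ∃ u ∈ S, g - u ∈ H := by
  simp [cosetHull]

theorem subset_cosetHull (H : AddSubgroup G) (S : Finset G) : S ⊆ cosetHull H S := by
  intro x hx
  exact mem_cosetHull.2 ⟨x, hx, by simp⟩

theorem cosetHull_mono_right (H : AddSubgroup G) {S T : Finset G} (h : S ⊆ T) :
    cosetHull H S ⊆ cosetHull H T := by
  intro x hx
  obtain ⟨u, hu, hxu⟩ := mem_cosetHull.1 hx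
  exact mem_cosetHull.2 ⟨u, h hu, hxu⟩

theorem cosetHull_mono_left {H K : AddSubgroup G} (h : H ≤ K) (S : Finset G) :
    cosetHull H S ⊆ cosetHull K S := by
  intro x hx
  obtain ⟨u, hu, hxu⟩ := mem_cosetHull.1 hx
  exact mem_cosetHull.2 ⟨u, hu, h hxu⟩

theorem cosetHull_empty (H : AddSubgroup G) : cosetHull H (∅ : Finset G) = ∅ := by
  ext x
  simp [mem_cosetHull]

theorem mem_cosetHull_singleton {H : AddSubgroup G} {a g : G} :
    g ∈ cosetHull H {a} ↔ g - a ∈ H := by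
  simp [mem_cosetHull]

theorem card_cosetHull_singleton (H : AddSubgroup G) (a : G) :
    (cosetHull H {a}).card = Nat.card H := by
  rw [← Nat.card_eq_finsetCard]
  refine Nat.card_congr ⟨fun g => ⟨g.1 - a, mem_cosetHull_singleton.1 g.2⟩,
    fun h => ⟨h.1 + a, mem_cosetHull_singleton.2 (by simp)⟩, ?_, ?_⟩
  · intro g
    simp
  · intro h
    simp

theorem cosetHull_absorb {H K : AddSubgroup G} (hHK : H ≤ K) (S : Finset G) {g u : G}
    (hu : u ∈ cosetHull K S) (h : g - u ∈ H) : g ∈ cosetHull K S := by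
  obtain ⟨v, hv, huv⟩ := mem_cosetHull.1 hu
  exact mem_cosetHull.2 ⟨v, hv, sub_mem_trans (hHK h) huv⟩

theorem cosetHull_eq_self {H : AddSubgroup G} {S : Finset G} (h : H ≤ addStab S) :
    cosetHull H S = S := by
  apply Finset.Subset.antisymm _ (subset_cosetHull H S)
  intro x hx
  obtain ⟨u, hu, hxu⟩ := mem_cosetHull.1 hx
  simpa using (h hxu u).2 hu

variable [DecidableEq G]

theorem cosetHull_union (H : AddSubgroup G) (S T : Finset G) :
    cosetHull H (S ∪ T) = cosetHull H S ∪ cosetHull H T := by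
  ext x
  simp only [mem_cosetHull, Finset.mem_union]
  grind

theorem cosetHull_insert (H : AddSubgroup G) (a : G) (S : Finset G) :
    cosetHull H (insert a S) = cosetHull H {a} ∪ cosetHull H S := by
  rw [Finset.insert_eq, cosetHull_union]

theorem card_dvd_card_cosetHull (H : AddSubgroup G) (S : Finset G) :
    Nat.card H ∣ (cosetHull H S).card := by
  induction S using Finset.induction_on with
  | empty => simp [cosetHull_empty]
  | insert a S _ ih =>
    rw [cosetHull_insert]
    by_cases haS : a ∈ cosetHull H S
    · rwa [Finset.union_eq_right.2]
      intro x hx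
      exact cosetHull_absorb le_rfl S haS (mem_cosetHull_singleton.1 hx)
    · rw [Finset.card_union_of_disjoint, card_cosetHull_singleton]
      · exact Dvd.dvd.add dvd_rfl ih
      · rw [Finset.disjoint_left]
        intro x hx hxS
        exact haS (cosetHull_absorb le_rfl S hxS
          (sub_mem_symm (mem_cosetHull_singleton.1 hx)))

theorem le_addStab_cosetHull (H : AddSubgroup G) (S : Finset G) :
    H ≤ addStab (cosetHull H S) := by
  intro h hh
  apply mem_addStab_of_forall
  intro x hx
  exact cosetHull_absorb le_rfl S hx (by simpa using hh)

theorem cosetHull_add_cosetHull (H : AddSubgroup G) (S T : Finset G) :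
    cosetHull H S + cosetHull H T = cosetHull H (S + T) := by
  ext x
  constructor
  · intro hx
    obtain ⟨y, hy, z, hz, rfl⟩ := Finset.mem_add.1 hx
    obtain ⟨u, hu, hyu⟩ := mem_cosetHull.1 hy
    obtain ⟨v, hv, hzv⟩ := mem_cosetHull.1 hz
    refine mem_cosetHull.2 ⟨u + v, Finset.add_mem_add hu hv, ?_⟩
    rw [add_sub_add_comm]
    exact H.add_mem hyu hzv
  · intro hx
    obtain ⟨w, hw, hxw⟩ := mem_cosetHull.1 hx
    obtain ⟨u, hu, v, hv, rfl⟩ := Finset.mem_add.1 hw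
    refine Finset.mem_add.2 ⟨x - v, mem_cosetHull.2 ⟨u, hu, ?_⟩, v, subset_cosetHull H T hv,
      by simp⟩
    rwa [sub_sub, add_comm v u]

/-- The inequality of Kneser's theorem for the pair `A`, `B`. -/
def KneserBound (A B : Finset G) : Prop :=
  A.card + B.card ≤ (A + B).card + Nat.card (addStab (A + B))

/-- The bound for the pair of coset hulls modulo the stabilizer of the sum. -/
theorem KneserBound.strong {A B : Finset G}
    (h : KneserBound (cosetHull (addStab (A + B)) A) (cosetHull (addStab (A + B)) B)) :
    (cosetHull (addStab (A + B)) A).card + (cosetHull (addStab (A + B)) B).card ≤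
      (A + B).card + Nat.card (addStab (A + B)) := by
  unfold KneserBound at h
  rwa [cosetHull_add_cosetHull, cosetHull_eq_self le_rfl] at h

/-- The part of an `H`-periodic set `W` missed by `U + K` bounds from below what is gained in
passing from `U + K` to `U + H`. -/
theorem card_cosetHull_sdiff {H K : AddSubgroup G} (hKH : K ≤ H) {U W : Finset G}
    (hW : W ⊆ cosetHull H U) (hWH : H ≤ addStab W) :
    W.card + (cosetHull K U).card ≤ (cosetHull H U).card + (cosetHull K (U ∩ W)).card := by
  have hunion : W ∪ cosetHull K U ⊆ cosetHull H U :=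
    Finset.union_subset hW (cosetHull_mono_left hKH U)
  have hinter : W ∩ cosetHull K U ⊆ cosetHull K (U ∩ W) := by
    intro x hx
    obtain ⟨hxW, hxU⟩ := Finset.mem_inter.1 hx
    obtain ⟨u, hu, hxu⟩ := mem_cosetHull.1 hxU
    refine mem_cosetHull.2 ⟨u, Finset.mem_inter.2 ⟨hu, ?_⟩, hxu⟩
    have := (hWH (hKH (sub_mem_symm hxu)) x).2 hxW
    simpa using this
  have h₁ := Finset.card_le_card hunion
  have h₂ := Finset.card_le_card hinter
  have h₃ := Finset.card_union_add_card_inter W (cosetHull K U)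
  omega

/-- If `U` meets the `H`-periodic set `W` in `V₁ ∪ V₂`, and `U` has few `Kᵢ`-coset holes
compared to `Vᵢ`, then `W \ U` is large. -/
theorem card_add_card_le_card_sdiff {H K₁ K₂ : AddSubgroup G} (hK₁ : K₁ ≤ H) (hK₂ : K₂ ≤ H)
    {U W V₁ V₂ : Finset G} (hWU : W ⊆ cosetHull H U) (hWH : H ≤ addStab W)
    (hUW : U ∩ W = V₁ ∪ V₂) (hWcard : W.card = 2 * Nat.card H)
    (h₁ : (cosetHull H U).card + (cosetHull K₁ V₁).card + Nat.card K₁ ≤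
      Nat.card H + (cosetHull K₁ U).card)
    (h₂ : (cosetHull H U).card + (cosetHull K₂ V₂).card + Nat.card K₂ ≤
      Nat.card H + (cosetHull K₂ U).card) :
    Nat.card K₁ + Nat.card K₂ ≤ (W \ U).card := by
  have hhull : ∀ K ≤ H, ∀ S ⊆ U ∩ W, cosetHull K S ⊆ W := by
    intro K hK S hS x hx
    obtain ⟨u, hu, hxu⟩ := mem_cosetHull.1 hx
    simpa using (hWH (hK hxu) u).2 (Finset.mem_inter.1 (hS hu)).2
  have hV₁ : V₁ ⊆ U ∩ W := hUW ▸ Finset.subset_union_left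
  have hV₂ : V₂ ⊆ U ∩ W := hUW ▸ Finset.subset_union_right
  have hd₁ := card_cosetHull_sdiff hK₁ hWU hWH
  have hd₂ := card_cosetHull_sdiff hK₂ hWU hWH
  rw [hUW, cosetHull_union, Finset.union_comm] at hd₁
  rw [hUW, cosetHull_union] at hd₂
  have he₁ := Finset.card_sdiff_add_card (cosetHull K₁ V₂) (cosetHull K₁ V₁)
  have he₂ := Finset.card_sdiff_add_card (cosetHull K₂ V₁) (cosetHull K₂ V₂)
  set D₁ := cosetHull K₁ V₂ \ cosetHull K₁ V₁
  set D₂ := cosetHull K₂ V₁ \ cosetHull K₂ V₂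
  have hDunion := Finset.card_union_add_card_inter D₁ D₂
  have hDW : (D₁ ∪ D₂).card ≤ W.card := Finset.card_le_card (Finset.union_subset
    (Finset.sdiff_subset.trans (hhull K₁ hK₁ V₂ hV₂))
    (Finset.sdiff_subset.trans (hhull K₂ hK₂ V₁ hV₁)))
  have hDinter : D₁ ∩ D₂ ⊆ W \ U := by
    intro x hx
    obtain ⟨hx₁, hx₂⟩ := Finset.mem_inter.1 hx
    obtain ⟨hx₁, hx₁'⟩ := Finset.mem_sdiff.1 hx₁
    have hxW := hhull K₁ hK₁ V₂ hV₂ hx₁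
    refine Finset.mem_sdiff.2 ⟨hxW, fun hxU => ?_⟩
    have hxV : x ∈ V₁ ∪ V₂ := hUW ▸ Finset.mem_inter.2 ⟨hxU, hxW⟩
    rcases Finset.mem_union.1 hxV with h | h
    · exact hx₁' (subset_cosetHull _ _ h)
    · exact (Finset.mem_sdiff.1 hx₂).2 (subset_cosetHull _ _ h)
  have hDcard := Finset.card_le_card hDinter
  omega

/-- The lexicographic descent used to prove Kneser's theorem. -/
def KneserDescent (A' B' A B : Finset G) : Prop :=
  (A' + B').card < (A + B).card ∨
    (A' + B').card = (A + B).card ∧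
      (A.card + B.card < A'.card + B'.card ∨
        A.card + B.card = A'.card + B'.card ∧ A'.card < A.card)

/-- `C` is an `H`-periodic part of `A + B` of large size. -/
def IsConvergent (A B C : Finset G) (H : AddSubgroup G) : Prop :=
  C.Nonempty ∧ C ⊆ A + B ∧ H ≤ addStab C ∧
    (A ∩ B).card + (cosetHull H (A ∪ B)).card ≤ C.card + Nat.card H

theorem exists_isConvergent {A B : Finset G} (hne : (A ∩ B).Nonempty) (hAB : ¬ A ⊆ B)
    (ih : ∀ A' B' : Finset G, A'.Nonempty → KneserDescent A' B' A B → KneserBound A' B') :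
    ∃ C H, IsConvergent A B C H := by
  have hne' : (A ∪ B).Nonempty := hne.mono (Finset.inter_subset_left.trans
    Finset.subset_union_left)
  have hsub : (A ∩ B) + (A ∪ B) ⊆ A + B := by
    intro x hx
    obtain ⟨y, hy, z, hz, rfl⟩ := Finset.mem_add.1 hx
    obtain ⟨hyA, hyB⟩ := Finset.mem_inter.1 hy
    rcases Finset.mem_union.1 hz with hz | hz
    · rw [add_comm y z]
      exact Finset.add_mem_add hz hyB
    · exact Finset.add_mem_add hyA hz
  have hlt : (A ∩ B).card < A.card := by
    apply Finset.card_lt_card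
    refine ⟨Finset.inter_subset_left, fun h => hAB fun x hx => ?_⟩
    exact (Finset.mem_inter.1 (h hx)).2
  set H := addStab ((A ∩ B) + (A ∪ B)) with hH
  have hb := Finset.card_le_card (subset_cosetHull H (A ∩ B))
  refine ⟨(A ∩ B) + (A ∪ B), H, hne.add hne', hsub, le_rfl, ?_⟩
  have hkn := KneserBound.strong (A := A ∩ B) (B := A ∪ B) (by
    apply ih
    · exact hne.mono (subset_cosetHull _ _)
    · unfold KneserDescent
      rw [cosetHull_add_cosetHull, cosetHull_eq_self le_rfl, ← hH]
      have h₁ := Finset.card_le_card hsub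
      have h₃ := Finset.card_le_card (subset_cosetHull H (A ∪ B))
      have h₄ := Finset.card_union_add_card_inter A B
      omega)
  rw [← hH] at hkn
  omega

/-- Adding to a convergent with minimal subgroup a piece of a missing coset. -/
theorem exists_subgroup_of_minimal {A B C : Finset G} {H : AddSubgroup G}
    (hC : IsConvergent A B C H)
    (hmin : ∀ C' H', IsConvergent A B C' H' → Nat.card H ≤ Nat.card H')
    (hcard : (A + B).card < A.card + B.card)
    (ih : ∀ A' B' : Finset G, A'.Nonempty → KneserDescent A' B' A B → KneserBound A' B')
    {a b : G} (hab : ¬ cosetHull H {a + b} ⊆ A + B) {x y : G} (hxy : x + y = a + b)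
    {P Q : Finset G} (hP : P.Nonempty) (hQ : Q.Nonempty)
    (hPA : P ⊆ A ∩ cosetHull H {x}) (hQB : Q ⊆ B ∩ cosetHull H {y}) :
    ∃ K ≤ H, (cosetHull H (A ∪ B)).card + (cosetHull K P).card + (cosetHull K Q).card +
        Nat.card K ≤ Nat.card H + (cosetHull K (A ∪ B)).card ∧
      (cosetHull H (A ∪ B)).card + P.card + Q.card <
        Nat.card H + (A ∪ B).card + Nat.card K := by
  obtain ⟨hCne, hCsub, hCH, hCcard⟩ := hC
  set K := addStab (P + Q) with hK
  have hPQsub : P + Q ⊆ A + B := Finset.add_subset_add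
    (hPA.trans Finset.inter_subset_left) (hQB.trans Finset.inter_subset_left)
  have hPQcoset : P + Q ⊆ cosetHull H {a + b} := by
    intro z hz
    obtain ⟨p, hp, q, hq, rfl⟩ := Finset.mem_add.1 hz
    rw [mem_cosetHull_singleton, ← hxy, add_sub_add_comm]
    exact H.add_mem (mem_cosetHull_singleton.1 (Finset.mem_inter.1 (hPA hp)).2)
      (mem_cosetHull_singleton.1 (Finset.mem_inter.1 (hQB hq)).2)
  obtain ⟨z, hz⟩ := hP.add hQ
  have hKH : K ≤ H := by
    intro g hg
    have h₁ := mem_cosetHull_singleton.1 (hPQcoset ((hg z).2 hz))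
    have h₂ := mem_cosetHull_singleton.1 (hPQcoset hz)
    simpa using sub_mem_trans h₁ (sub_mem_symm h₂)
  have hCdisj : Disjoint C (P + Q) := by
    rw [Finset.disjoint_left]
    intro w hw hwPQ
    apply hab
    intro v hv
    apply hCsub
    have h₁ := mem_cosetHull_singleton.1 hv
    have h₂ := mem_cosetHull_singleton.1 (hPQcoset hwPQ)
    simpa using (hCH (sub_mem_trans h₁ (sub_mem_symm h₂)) w).2 hw
  have hKlt : Nat.card K < Nat.card H := by
    refine lt_of_le_of_ne (AddSubgroup.card_le_of_le hKH) fun heq => hab ?_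
    have hKeq : K = H := AddSubgroup.eq_of_le_of_card_ge hKH heq.ge
    intro v hv
    apply hPQsub
    have h₁ := mem_cosetHull_singleton.1 hv
    have h₂ := mem_cosetHull_singleton.1 (hPQcoset hz)
    have h₃ : v - z ∈ K := hKeq ▸ sub_mem_trans h₁ (sub_mem_symm h₂)
    simpa using (h₃ z).2 hz
  have hunion := Finset.card_union_of_disjoint hCdisj
  have hunionsub := Finset.card_le_card (Finset.union_subset hCsub hPQsub)
  have hCpos := hCne.card_pos
  have hkn := KneserBound.strong (A := P) (B := Q) (by
    apply ih
    · exact hP.mono (subset_cosetHull _ _)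
    · left
      rw [cosetHull_add_cosetHull, cosetHull_eq_self le_rfl]
      omega)
  rw [← hK] at hkn
  have hPle := Finset.card_le_card (subset_cosetHull K P)
  have hQle := Finset.card_le_card (subset_cosetHull K Q)
  have hcards := Finset.card_union_add_card_inter A B
  refine ⟨K, hKH, ?_, by omega⟩
  have hnot : ¬ IsConvergent A B (C ∪ (P + Q)) K := fun h =>
    absurd (hmin _ _ h) (not_le.2 hKlt)
  have hstab : K ≤ addStab (C ∪ (P + Q)) := by
    intro g hg
    apply mem_addStab_of_forall
    intro w hw
    rcases Finset.mem_union.1 hw with hw | hw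
    · exact Finset.mem_union_left _ ((hCH (hKH hg) w).2 hw)
    · exact Finset.mem_union_right _ ((hg w).2 hw)
  have hlt : C.card + (P + Q).card + Nat.card K <
      (A ∩ B).card + (cosetHull K (A ∪ B)).card := by
    by_contra hle
    refine hnot ⟨hCne.mono Finset.subset_union_left,
      Finset.union_subset hCsub hPQsub, hstab, ?_⟩
    omega
  have hHdvd : Nat.card K ∣ Nat.card H := AddSubgroup.card_dvd_of_le hKH
  apply add_le_of_dvd_of_lt
  · exact ((hHdvd.trans (card_dvd_card_cosetHull H _)).add (card_dvd_card_cosetHull K P)).add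
      (card_dvd_card_cosetHull K Q)
  · exact hHdvd.add (card_dvd_card_cosetHull K _)
  · omega

/-- A convergent with minimal subgroup `H` cannot coexist with a coset of `H` that meets `A + B`
without being contained in it, if `A + B` is small. -/
theorem false_of_missing_coset {A B C : Finset G} {H : AddSubgroup G}
    (hC : IsConvergent A B C H)
    (hmin : ∀ C' H', IsConvergent A B C' H' → Nat.card H ≤ Nat.card H')
    (hcard : (A + B).card < A.card + B.card)
    (ih : ∀ A' B' : Finset G, A'.Nonempty → KneserDescent A' B' A B → KneserBound A' B')
    {a b : G} (ha : a ∈ A) (hb : b ∈ B) (hab : ¬ cosetHull H {a + b} ⊆ A + B) : False := by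
  have key := fun {x y : G} (hxy : x + y = a + b) {P Q : Finset G} =>
    exists_subgroup_of_minimal hC hmin hcard ih hab hxy (P := P) (Q := Q)
  obtain ⟨A₁, hA₁⟩ : ∃ S, S = A ∩ cosetHull H {a} := ⟨_, rfl⟩
  obtain ⟨B₁, hB₁⟩ : ∃ S, S = B ∩ cosetHull H {b} := ⟨_, rfl⟩
  obtain ⟨A₂, hA₂⟩ : ∃ S, S = A ∩ cosetHull H {b} := ⟨_, rfl⟩
  obtain ⟨B₂, hB₂⟩ : ∃ S, S = B ∩ cosetHull H {a} := ⟨_, rfl⟩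
  have hA₁ne : A₁.Nonempty :=
    ⟨a, hA₁ ▸ Finset.mem_inter.2 ⟨ha, subset_cosetHull H _ (Finset.mem_singleton_self a)⟩⟩
  have hB₁ne : B₁.Nonempty :=
    ⟨b, hB₁ ▸ Finset.mem_inter.2 ⟨hb, subset_cosetHull H _ (Finset.mem_singleton_self b)⟩⟩
  have hWa : cosetHull H {a} ⊆ cosetHull H (A ∪ B) :=
    cosetHull_mono_right H (by simpa using Or.inl ha)
  have hWb : cosetHull H {b} ⊆ cosetHull H (A ∪ B) :=
    cosetHull_mono_right H (by simpa using Or.inr hb)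
  have hUa : (A ∪ B) ∩ cosetHull H {a} = A₁ ∪ B₂ := by
    rw [hA₁, hB₂, Finset.union_inter_distrib_right]
  have hUb : (A ∪ B) ∩ cosetHull H {b} = A₂ ∪ B₁ := by
    rw [hA₂, hB₁, Finset.union_inter_distrib_right]
  have hca := card_cosetHull_singleton H a
  have hcb := card_cosetHull_singleton H b
  obtain ⟨K₁, hK₁H, hbig₁, hsmall₁⟩ := key rfl hA₁ne hB₁ne hA₁.subset hB₁.subset
  have hda := card_cosetHull_sdiff hK₁H hWa (le_addStab_cosetHull H _)
  have hdb := card_cosetHull_sdiff hK₁H hWb (le_addStab_cosetHull H _)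
  rw [hUa] at hda
  rw [hUb] at hdb
  have hK₁pos : 0 < Nat.card K₁ := Nat.card_pos
  by_cases hba : b - a ∈ H
  · have hcos : cosetHull H {b} = cosetHull H {a} := by
      ext x
      rw [mem_cosetHull_singleton, mem_cosetHull_singleton]
      exact ⟨fun h => sub_mem_trans h hba, fun h => sub_mem_trans h (sub_mem_symm hba)⟩
    have hBB : B₂ = B₁ := by rw [hB₁, hB₂, hcos]
    rw [hBB, cosetHull_union K₁ A₁ B₁] at hda
    have := Finset.card_union_le (cosetHull K₁ A₁) (cosetHull K₁ B₁)
    omega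
  rcases B₂.eq_empty_or_nonempty with hB₂e | hB₂ne
  · rw [hB₂e, Finset.union_empty] at hda
    omega
  rcases A₂.eq_empty_or_nonempty with hA₂e | hA₂ne
  · rw [hA₂e, Finset.empty_union] at hdb
    omega
  obtain ⟨K₂, hK₂H, hbig₂, hsmall₂⟩ := key (add_comm b a) hA₂ne hB₂ne hA₂.subset hB₂.subset
  have hdisj : Disjoint (cosetHull H {a}) (cosetHull H {b}) := by
    rw [Finset.disjoint_left]
    intro x hxa hxb
    exact hba (sub_mem_trans (sub_mem_symm (mem_cosetHull_singleton.1 hxb))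
      (mem_cosetHull_singleton.1 hxa))
  obtain ⟨W, hW⟩ : ∃ S, S = cosetHull H {a} ∪ cosetHull H {b} := ⟨_, rfl⟩
  have hWcard : W.card = 2 * Nat.card H := by
    rw [hW, Finset.card_union_of_disjoint hdisj]
    omega
  have hWab : W = cosetHull H {a, b} := by
    rw [hW, cosetHull_insert]
  have hWH : H ≤ addStab W := by
    rw [hWab]
    exact le_addStab_cosetHull H _
  have hWU : W ⊆ cosetHull H (A ∪ B) := hW ▸ Finset.union_subset hWa hWb
  have hUW : (A ∪ B) ∩ W = (A₁ ∪ B₁) ∪ (A₂ ∪ B₂) := by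
    rw [hW, Finset.inter_union_distrib_left, hUa, hUb, Finset.union_comm A₂ B₁,
      Finset.union_union_union_comm, Finset.union_comm B₂ A₂]
  have hcount := card_add_card_le_card_sdiff hK₁H hK₂H hWU hWH hUW hWcard
    (by
      have := Finset.card_union_le (cosetHull K₁ A₁) (cosetHull K₁ B₁)
      rw [← cosetHull_union K₁ A₁ B₁] at this
      omega)
    (by
      have := Finset.card_union_le (cosetHull K₂ A₂) (cosetHull K₂ B₂)
      rw [← cosetHull_union K₂ A₂ B₂] at this
      omega)
  have hd₀ := Finset.card_le_card (Finset.union_subset hWU (subset_cosetHull H (A ∪ B)))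
  have hi₀ := Finset.card_union_add_card_inter W (A ∪ B)
  have hWd := Finset.card_sdiff_add_card_inter W (A ∪ B)
  have hUWcard : (W ∩ (A ∪ B)).card ≤ A₁.card + B₁.card + (A₂.card + B₂.card) := by
    rw [Finset.inter_comm, hUW]
    exact (Finset.card_union_le _ _).trans
      (add_le_add (Finset.card_union_le _ _) (Finset.card_union_le _ _))
  omega

theorem kneserBound_of_inter_nonempty {A B : Finset G} (hne : (A ∩ B).Nonempty)
    (hAB : ¬ A ⊆ B)
    (ih : ∀ A' B' : Finset G, A'.Nonempty → KneserDescent A' B' A B → KneserBound A' B') :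
    KneserBound A B := by
  classical
  have hex : ∃ m C H, IsConvergent A B C H ∧ Nat.card H = m := by
    obtain ⟨C, H, h⟩ := exists_isConvergent hne hAB ih
    exact ⟨_, C, H, h, rfl⟩
  obtain ⟨C, H, hC, hHm⟩ := Nat.find_spec hex
  have hmin : ∀ C' H', IsConvergent A B C' H' → Nat.card H ≤ Nat.card H' := by
    intro C' H' h
    rw [hHm]
    exact Nat.find_min' hex ⟨C', H', h, rfl⟩
  clear hHm
  by_contra hbad
  unfold KneserBound at hbad
  rw [not_le] at hbad
  have hHK : ¬ H ≤ addStab (A + B) := by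
    intro hle
    obtain ⟨-, hCsub, -, hCcard⟩ := hC
    have h₁ := Finset.card_le_card hCsub
    have h₂ := Finset.card_le_card (subset_cosetHull H (A ∪ B))
    have h₃ := AddSubgroup.card_le_of_le hle
    have h₄ := Finset.card_union_add_card_inter A B
    omega
  obtain ⟨a, ha, b, hb, hab⟩ : ∃ a ∈ A, ∃ b ∈ B, ¬ cosetHull H {a + b} ⊆ A + B := by
    by_contra hall
    push Not at hall
    apply hHK
    intro h hh
    apply mem_addStab_of_forall
    intro x hx
    obtain ⟨a, ha, b, hb, rfl⟩ := Finset.mem_add.1 hx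
    exact hall a ha b hb (mem_cosetHull_singleton.2 (by simpa using hh))
  exact false_of_missing_coset hC hmin (by omega) ih ha hb hab

theorem KneserBound.of_translate {A B : Finset G} (g : G) (h : KneserBound ({g} + A) B) :
    KneserBound A B := by
  unfold KneserBound at h ⊢
  rw [add_assoc, Finset.card_singleton_add, Finset.card_singleton_add] at h
  have hle : addStab ({g} + (A + B)) ≤ addStab (A + B) := by
    intro u hu
    apply mem_addStab_of_forall
    intro x hx
    have hmem := (hu (g + x)).2 (Finset.add_mem_add (Finset.mem_singleton_self g) hx)
    rw [add_left_comm u g x, Finset.mem_add] at hmem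
    obtain ⟨_, hg, y, hy, hyx⟩ := hmem
    rw [Finset.mem_singleton.1 hg] at hyx
    rwa [← add_left_cancel hyx]
  have := AddSubgroup.card_le_of_le hle
  omega

theorem kneserBound_of_translates_subset {A B : Finset G} (hA : A.Nonempty)
    (h : ∀ a ∈ A, ∀ b ∈ B, ∀ a' ∈ A, b - a + a' ∈ B) : KneserBound A B := by
  obtain ⟨a₀, ha₀⟩ := hA
  have hsub : A ⊆ cosetHull (addStab (A + B)) {a₀} := by
    intro a' ha'
    rw [mem_cosetHull_singleton]
    apply mem_addStab_of_forall
    intro x hx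
    obtain ⟨a, ha, b, hb, rfl⟩ := Finset.mem_add.1 hx
    refine Finset.mem_add.2 ⟨a, ha, b - a₀ + a', h a₀ ha₀ b hb a' ha', ?_⟩
    abel
  have h₁ := Finset.card_le_card hsub
  rw [card_cosetHull_singleton] at h₁
  have h₂ : B.card ≤ (A + B).card := Finset.card_le_card_add_left ⟨a₀, ha₀⟩
  unfold KneserBound
  omega

/-- **Kneser's theorem** for finite abelian groups. -/
theorem kneser (A B : Finset G) (hA : A.Nonempty) : KneserBound A B := by
  have ih : ∀ A' B' : Finset G, A'.Nonempty → KneserDescent A' B' A B → KneserBound A' B' :=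
    fun A' B' hA' _ => kneser A' B' hA'
  by_cases h : ∀ a ∈ A, ∀ b ∈ B, ∀ a' ∈ A, b - a + a' ∈ B
  · exact kneserBound_of_translates_subset hA h
  push Not at h
  obtain ⟨a, ha, b, hb, a', ha', hmem⟩ := h
  apply KneserBound.of_translate (b - a)
  apply kneserBound_of_inter_nonempty
  · refine ⟨b, Finset.mem_inter.2 ⟨?_, hb⟩⟩
    exact Finset.mem_add.2 ⟨b - a, Finset.mem_singleton_self _, a, ha, by simp⟩
  · intro hsub
    exact hmem (hsub (Finset.add_mem_add (Finset.mem_singleton_self _) ha'))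
  · unfold KneserDescent at ih ⊢
    rw [add_assoc, Finset.card_singleton_add, Finset.card_singleton_add]
    exact ih
termination_by ((A + B).card, 2 * Fintype.card G - (A.card + B.card), A.card)
decreasing_by
  rename_i hdesc
  have h₁ := Finset.card_le_univ A'
  have h₂ := Finset.card_le_univ B'
  simp only [Prod.lex_def]
  unfold KneserDescent at hdesc
  omega

/-- Kneser's inequality modulo the stabilizer of a set of which `A + T` is a summand. -/
theorem card_cosetHull_add {A T R Z : Finset G} (hA : A.Nonempty)
    (hZ : A + T + R = Z) :
    (cosetHull (addStab Z) A).card + (cosetHull (addStab Z) T).card ≤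
      (cosetHull (addStab Z) (A + T)).card + Nat.card (addStab Z) := by
  have hstab : addStab (cosetHull (addStab Z) (A + T)) ≤ addStab Z := by
    intro g hg
    apply mem_addStab_of_forall
    intro z hz
    rw [← hZ] at hz
    obtain ⟨w, hw, r, hr, rfl⟩ := Finset.mem_add.1 hz
    have h₁ := (hg w).2 (subset_cosetHull _ _ hw)
    have h₂ := Finset.add_mem_add h₁ (subset_cosetHull (addStab Z) R hr)
    rwa [cosetHull_add_cosetHull, hZ, cosetHull_eq_self le_rfl, add_assoc] at h₂
  have hk := kneser _ (cosetHull (addStab Z) T) (hA.mono (subset_cosetHull (addStab Z) A))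
  unfold KneserBound at hk
  rw [cosetHull_add_cosetHull] at hk
  have := AddSubgroup.card_le_of_le hstab
  omega

theorem card_cosetHull_neg (H : AddSubgroup G) (S : Finset G) :
    (cosetHull H (-S)).card = (cosetHull H S).card := by
  have : cosetHull H (-S) = -cosetHull H S := by
    ext x
    rw [Finset.mem_neg', mem_cosetHull, mem_cosetHull]
    constructor
    · rintro ⟨u, hu, hxu⟩
      refine ⟨-u, Finset.mem_neg'.1 hu, ?_⟩
      simpa [sub_eq_add_neg, add_comm] using H.neg_mem hxu
    · rintro ⟨u, hu, hxu⟩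
      refine ⟨-u, Finset.neg_mem_neg hu, ?_⟩
      simpa [sub_eq_add_neg, add_comm] using H.neg_mem hxu
  rw [this, Finset.card_neg]

theorem card_cosetHull_zero_pair {H : AddSubgroup G} {s : G} (hs : s ∉ H) :
    (cosetHull H {0, s}).card = 2 * Nat.card H := by
  rw [cosetHull_insert, Finset.card_union_of_disjoint, card_cosetHull_singleton,
    card_cosetHull_singleton, two_mul]
  rw [Finset.disjoint_left]
  intro x hx hxs
  rw [mem_cosetHull_singleton] at hx hxs
  exact hs (by simpa using sub_mem_trans (sub_mem_symm hxs) hx)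

end Kneser

section SumFreeSets

variable {n : ℕ}

theorem iterSum_neg (A : Finset (ZMod n)) (j : ℕ) : iterSum j (-A) = -iterSum j A := by
  induction j with
  | zero => simp [iterSum]
  | succ j ih =>
    simp only [iterSum]
    rw [ih, neg_add]

theorem zero_mem_iterSum {C : Finset (ZMod n)} (hC : 0 ∈ C) (j : ℕ) : 0 ∈ iterSum j C := by
  induction j with
  | zero => exact Finset.mem_singleton_self 0
  | succ j ih => exact Finset.mem_add.2 ⟨0, hC, 0, ih, add_zero 0⟩

theorem iterSum_singleton_zero (j : ℕ) : iterSum j ({0} : Finset (ZMod n)) = {0} := by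
  induction j with
  | zero => rfl
  | succ j ih => simp [iterSum, ih]

theorem iterSum_image {m : ℕ} (φ : ZMod n →+ ZMod m) (A : Finset (ZMod n)) (j : ℕ) :
    iterSum j (A.image φ) = (iterSum j A).image φ := by
  induction j with
  | zero => simp [iterSum]
  | succ j ih =>
    simp only [iterSum]
    rw [ih, Finset.image_add]

theorem sumFree_zero_iff {k l : ℕ} {A : Finset (ZMod n)} :
    SumFree {0} k l A ↔ Disjoint (iterSum k A) (iterSum l A) := by
  simp only [SumFree, noisy, iterSum_singleton_zero, Finset.disjoint_iff_inter_eq_empty]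
  simp only [Finset.singleton_zero, add_zero]

theorem SumFree.card_le_mu [NeZero n] {k l : ℕ} {C A : Finset (ZMod n)}
    (h : SumFree C k l A) : A.card ≤ mu n k l C := by
  refine le_csSup ⟨n, ?_⟩ ⟨A, h, rfl⟩
  rintro m ⟨B, -, rfl⟩
  exact (Finset.card_le_univ B).trans_eq (ZMod.card n)

/-- The difference of the two noisy sums, as a sum of iterated sums. -/
def noisyDiff (C : Finset (ZMod n)) (k l : ℕ) (A : Finset (ZMod n)) : Finset (ZMod n) :=
  iterSum k A + (iterSum l (-A) + (iterSum (k - 1) C + (iterSum (l - 1) (-C) + {0})))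

theorem SumFree.zero_notMem_noisyDiff {k l : ℕ} {C A : Finset (ZMod n)}
    (h : SumFree C k l A) : 0 ∉ noisyDiff C k l A := by
  intro h0
  unfold noisyDiff at h0
  simp only [iterSum_neg, Finset.mem_add, Finset.mem_neg', Finset.mem_singleton] at h0
  obtain ⟨x, hx, _, ⟨y, hy, _, ⟨u, hu, _, ⟨v, hv, _, rfl, rfl⟩, rfl⟩, rfl⟩, hsum⟩ := h0
  have hmem : x + u ∈ noisy C k A ∩ noisy C l A := by
    refine Finset.mem_inter.2 ⟨Finset.add_mem_add hx hu, ?_⟩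
    have hxu : x + u = -y + -v := by
      linear_combination hsum
    rw [hxu]
    exact Finset.add_mem_add hy hv
  unfold SumFree at h
  rw [h] at hmem
  simp at hmem

theorem sub_mem_noisyDiff {k l : ℕ} {C A : Finset (ZMod n)} (hC : 0 ∈ C) {x y : ZMod n}
    (hx : x ∈ iterSum k A) (hy : y ∈ iterSum l A) : x - y ∈ noisyDiff C k l A := by
  have hC' : (0 : ZMod n) ∈ -C := Finset.mem_neg'.2 (by simpa using hC)
  have h := Finset.add_mem_add (zero_mem_iterSum hC (k - 1)) (Finset.add_mem_add
    (zero_mem_iterSum hC' (l - 1)) (Finset.mem_singleton_self (0 : ZMod n)))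
  have hy' : -y ∈ iterSum l (-A) := by
    rw [iterSum_neg]
    exact Finset.neg_mem_neg hy
  have h' := Finset.add_mem_add hx (Finset.add_mem_add hy' h)
  simpa [sub_eq_add_neg, noisyDiff] using h'

/-- A subgroup of `ZMod n` is the kernel of a surjection onto some `ZMod e`. -/
theorem exists_surjective_ker_eq (H : AddSubgroup (ZMod n)) :
    ∃ φ : ZMod n →+ ZMod H.index, Function.Surjective φ ∧ ∀ x, φ x = 0 ↔ x ∈ H := by
  have hcyc : IsAddCyclic (ZMod n ⧸ H) :=
    isAddCyclic_of_surjective (QuotientAddGroup.mk' H) (QuotientAddGroup.mk'_surjective H)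
  let ψ : ZMod H.index ≃+ ZMod n ⧸ H := zmodAddCyclicAddEquiv hcyc
  refine ⟨ψ.symm.toAddMonoidHom.comp (QuotientAddGroup.mk' H),
    ψ.symm.surjective.comp (QuotientAddGroup.mk'_surjective H), fun x => ?_⟩
  simp

variable [NeZero n]

theorem card_cosetHull_iterSum_add {A T R Z : Finset (ZMod n)} (hA : A.Nonempty)
    (j : ℕ) (hZ : iterSum j A + T + R = Z) :
    j * (cosetHull (addStab Z) A).card + (cosetHull (addStab Z) T).card ≤
      (cosetHull (addStab Z) (iterSum j A + T)).card + j * Nat.card (addStab Z) := by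
  induction j generalizing R with
  | zero => simp [iterSum, Finset.singleton_zero]
  | succ j ih =>
    simp only [iterSum] at hZ ⊢
    have h₁ := ih (R := A + R) (by rw [← hZ]; abel)
    have h₂ := card_cosetHull_add (T := iterSum j A + T) (R := R) (Z := Z) hA
      (by rw [← hZ]; abel)
    rw [add_assoc A, add_mul, add_mul]
    omega

/-- A set whose noisy difference is not stable under `s` has at most `n / (k + l)` elements. -/
theorem SumFree.mul_card_le {k l : ℕ} {s : ZMod n} {A : Finset (ZMod n)} (hA : A.Nonempty)
    (hk : 1 ≤ k) (hl : 1 ≤ l) (h : SumFree {0, s} k l A)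
    (hs : s ∉ addStab (noisyDiff {0, s} k l A)) : (k + l) * A.card ≤ n := by
  have h0 := h.zero_notMem_noisyDiff
  obtain ⟨Z, hZ⟩ : ∃ Z, noisyDiff {0, s} k l A = Z := ⟨_, rfl⟩
  have hpair := card_cosetHull_zero_pair hs
  rw [hZ] at hs h0 hpair
  obtain ⟨C, hC⟩ : ∃ C : Finset (ZMod n), {0, s} = C := ⟨_, rfl⟩
  rw [hC] at hZ hpair
  have hCne : C.Nonempty := hC ▸ Finset.insert_nonempty _ _
  unfold noisyDiff at hZ
  have b₁ := card_cosetHull_iterSum_add (R := 0) hA k (by rw [add_zero, hZ])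
  have b₂ := card_cosetHull_iterSum_add (R := iterSum k A) hA.neg l
    (by rw [add_comm, hZ])
  have b₃ := card_cosetHull_iterSum_add (R := iterSum k A + iterSum l (-A)) hCne (k - 1)
    (by rw [add_comm, add_assoc, hZ])
  have b₄ := card_cosetHull_iterSum_add
    (R := iterSum k A + (iterSum l (-A) + iterSum (k - 1) C)) hCne.neg (l - 1)
    (by rw [add_comm, add_assoc, add_assoc, hZ])
  rw [hZ, cosetHull_eq_self le_rfl] at b₁
  rw [card_cosetHull_neg] at b₂ b₄
  rw [card_cosetHull_singleton] at b₄
  have hdisj : Disjoint Z (cosetHull (addStab Z) {0}) := by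
    rw [Finset.disjoint_left]
    intro x hx hx0
    rw [mem_cosetHull_singleton] at hx0
    have := (sub_mem_symm hx0 x).2 hx
    simp only [zero_sub, neg_add_cancel] at this
    exact h0 this
  have hn := Finset.card_le_univ (Z ∪ cosetHull (addStab Z) {0})
  rw [Finset.card_union_of_disjoint hdisj, card_cosetHull_singleton, ZMod.card] at hn
  have hAle := Finset.card_le_card (subset_cosetHull (addStab Z) A)
  rw [hpair] at b₃ b₄
  obtain ⟨k, rfl⟩ := Nat.exists_eq_add_of_le' hk
  obtain ⟨l, rfl⟩ := Nat.exists_eq_add_of_le' hl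
  simp only [Nat.add_sub_cancel] at *
  nlinarith [Nat.mul_le_mul_left (k + 1 + (l + 1)) hAle]

theorem index_dvd_of_natCast_mem {H : AddSubgroup (ZMod n)} {s : ℕ} (hs : (s : ZMod n) ∈ H) :
    H.index ∣ s := by
  obtain ⟨φ, hφ, hker⟩ := exists_surjective_ker_eq H
  obtain ⟨m, hm⟩ := hφ 1
  rw [← ZMod.natCast_eq_zero_iff]
  have hφs : φ (s * m) = 0 := by
    rw [hker, ← ZMod.natCast_zmod_val m, mul_comm, ← nsmul_eq_mul]
    exact H.nsmul_mem hs _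
  rw [← nsmul_eq_mul, map_nsmul, hm, nsmul_eq_mul, mul_one] at hφs
  exact hφs

/-- A sum-free set is bounded by the lift of a sum-free set modulo the stabilizer of its noisy
difference. -/
theorem SumFree.card_le_mu_index {k l : ℕ} {C A : Finset (ZMod n)} (hC : 0 ∈ C)
    (h : SumFree C k l A) {H : AddSubgroup (ZMod n)} (hH : H ≤ addStab (noisyDiff C k l A)) :
    A.card ≤ mu H.index k l {0} * (n / H.index) := by
  obtain ⟨φ, hφ, hker⟩ := exists_surjective_ker_eq H
  have hindex : NeZero H.index := ⟨H.index_ne_zero_of_finite⟩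
  have hfree : SumFree {0} k l (A.image φ) := by
    rw [sumFree_zero_iff, Finset.disjoint_left]
    intro z hzk hzl
    rw [iterSum_image, Finset.mem_image] at hzk hzl
    obtain ⟨x, hx, rfl⟩ := hzk
    obtain ⟨y, hy, hxy⟩ := hzl
    have hmem : y - x ∈ H := by rw [← hker, map_sub, hxy, sub_self]
    have h0 := (hH hmem (x - y)).2 (sub_mem_noisyDiff hC hx hy)
    rw [sub_add_sub_cancel, sub_self] at h0
    exact h.zero_notMem_noisyDiff h0
  have hcard : Nat.card H = n / H.index := by
    have := H.card_mul_index
    rw [Nat.card_zmod] at this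
    exact Nat.eq_div_of_mul_eq_left hindex.ne this
  calc A.card ≤ n / H.index * (A.image φ).card := by
        apply Finset.card_le_mul_card_image
        intro z hz
        obtain ⟨a, -, rfl⟩ := Finset.mem_image.1 hz
        rw [← hcard, ← card_cosetHull_singleton H a]
        apply Finset.card_le_card
        intro x hx
        rw [mem_cosetHull_singleton, ← hker, map_sub, (Finset.mem_filter.1 hx).2, sub_self]
    _ ≤ mu H.index k l {0} * (n / H.index) := by
        rw [mul_comm]
        exact Nat.mul_le_mul_right _ hfree.card_le_mu

end SumFreeSets

theorem stmt12 (n : ℕ) [NeZero n] (k l s : ℕ) (hl : 1 ≤ l) (hkl : l < k) (hs : 1 ≤ s)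
    (d : ℕ) (hd : d = Nat.gcd s n) :
    mu n k l ({0, (s : ZMod n)} : Finset (ZMod n)) ≤
      max (d.divisors.sup fun e => mu e k l ({0} : Finset (ZMod e)) * (n / e))
        (n / (k + l)) := by
  apply csSup_le'
  rintro m ⟨A, hA, rfl⟩
  rcases A.eq_empty_or_nonempty with rfl | hne
  · simp
  rw [le_max_iff]
  by_cases hmem : (s : ZMod n) ∈ addStab (noisyDiff {0, (s : ZMod n)} k l A)
  · left
    refine (hA.card_le_mu_index (by simp) le_rfl).trans ?_
    refine Finset.le_sup (f := fun e => mu e k l ({0} : Finset (ZMod e)) * (n / e)) ?_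
    rw [Nat.mem_divisors, hd]
    refine ⟨Nat.dvd_gcd (index_dvd_of_natCast_mem hmem) ?_, (Nat.gcd_pos_of_pos_left n hs).ne'⟩
    simpa using (addStab (noisyDiff {0, (s : ZMod n)} k l A)).index_dvd_card
  · right
    rw [Nat.le_div_iff_mul_le (by omega), mul_comm]
    exact hA.mul_card_le hne (by omega) hl hmem
end
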